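/- Assume (A1) and (A2). For every λ > 0, exp( −∫_0^∞ ψ̃'(u(λ,s)) ds ) = κ_* α e^{−α c^{−1}(λ)} / ψ(λ). (This gives the closed form of the Laplace transform of the stationary population size Z: E[e^{−λZ}] = κ_* α e^{−α c^{−1}(λ)} / ψ(λ).) -/

import Mathlib

open MeasureTheory Set Filter intervalIntegral

lemma aux_exp (y : ℝ) (hy : 0 ≤ y) : 0 ≤ Real.exp (-y) - 1 + y ∧ Real.exp (-y) - 1 + y ≤ y ∧
    Real.exp (-y) - 1 + y ≤ y ^ 2 := by
  have h1 := Real.add_one_le_exp (-y)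
  have h2 := Real.add_one_le_exp y
  have h3 : Real.exp (-y) ≤ 1 := Real.exp_le_one_iff.2 (by linarith)
  have h4 : Real.exp (-y) * Real.exp y = 1 := by rw [← Real.exp_add]; simp
  refine ⟨by linarith, by linarith, ?_⟩
  have h5 : Real.exp (-y) * (y + 1) ≤ 1 := by
    exact (mul_le_mul_of_nonneg_left h2 (Real.exp_pos _).le).trans h4.le
  have h6 : Real.exp (-y) * (y + 1) ≤ (1 - y + y ^ 2) * (y + 1) := by
    have : 0 ≤ y ^ 3 := by positivity
    nlinarith
  have := le_of_mul_le_mul_right h6 (by linarith)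
  linarith

lemma aux_int (pi : Measure ℝ)
    (hpi : IntegrableOn (fun ℓ => min ℓ (ℓ ^ 2)) (Set.Ioi 0) pi) (x : ℝ) (hx : 0 ≤ x) :
    IntegrableOn (fun ℓ => Real.exp (-x * ℓ) - 1 + x * ℓ) (Set.Ioi 0) pi := by
  refine Integrable.mono' (hpi.const_mul (x + x ^ 2)) ?_ ?_
  · exact (by fun_prop : Continuous fun ℓ => Real.exp (-x * ℓ) - 1 + x * ℓ).aestronglyMeasurable
  · refine (ae_restrict_iff' measurableSet_Ioi).2 (ae_of_all _ fun ℓ hℓ => ?_)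
    have hℓ : 0 < ℓ := hℓ
    obtain ⟨h1, h2, h3⟩ := aux_exp (x * ℓ) (by positivity)
    rw [neg_mul, Real.norm_of_nonneg h1]
    rcases min_cases ℓ (ℓ ^ 2) with ⟨h, _⟩ | ⟨h, _⟩ <;> rw [h]
    · nlinarith [mul_nonneg (sq_nonneg x) hℓ.le]
    · nlinarith [mul_nonneg hx (sq_nonneg ℓ)]

lemma aux_deriv (pi : Measure ℝ)
    (hpi : IntegrableOn (fun ℓ => min ℓ (ℓ ^ 2)) (Set.Ioi 0) pi) (x : ℝ) (hx : 0 < x) :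
    HasDerivAt (fun x => ∫ ℓ in Set.Ioi (0 : ℝ), (Real.exp (-x * ℓ) - 1 + x * ℓ) ∂pi)
      (∫ ℓ in Set.Ioi (0 : ℝ), (Real.exp (-x * ℓ) * (-ℓ) + ℓ) ∂pi) x := by
  refine (hasDerivAt_integral_of_dominated_loc_of_deriv_le
    (F := fun x ℓ => Real.exp (-x * ℓ) - 1 + x * ℓ)
    (F' := fun x ℓ => Real.exp (-x * ℓ) * (-ℓ) + ℓ)
    (bound := fun ℓ => (x + 2) * min ℓ (ℓ ^ 2))
    (s := Set.Ioo 0 (x + 1)) (Ioo_mem_nhds hx (by linarith)) ?_ (aux_int pi hpi x hx.le) ?_ ?_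
    (hpi.const_mul (x + 2)) ?_).2
  · exact Eventually.of_forall fun x =>
      (by fun_prop : Continuous fun ℓ => Real.exp (-x * ℓ) - 1 + x * ℓ).aestronglyMeasurable
  · exact (by fun_prop : Continuous fun ℓ => Real.exp (-x * ℓ) * (-ℓ) + ℓ).aestronglyMeasurable
  · refine (ae_restrict_iff' measurableSet_Ioi).2 (ae_of_all _ fun ℓ hℓ y hy => ?_)
    have hℓ : 0 < ℓ := hℓ
    obtain ⟨hy0, hy1⟩ := hy
    have h1 := Real.add_one_le_exp (-y * ℓ)
    have h3 : Real.exp (-y * ℓ) ≤ 1 := Real.exp_le_one_iff.2 (by nlinarith)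
    have h4 := Real.exp_pos (-y * ℓ)
    rw [Real.norm_of_nonneg (by nlinarith)]
    rcases min_cases ℓ (ℓ ^ 2) with ⟨h, _⟩ | ⟨h, _⟩ <;> rw [h]
    · nlinarith [mul_pos h4 hℓ, mul_pos hx hℓ]
    · have : (1 - Real.exp (-y * ℓ)) * ℓ ≤ (y * ℓ) * ℓ :=
        mul_le_mul_of_nonneg_right (by linarith) hℓ.le
      have : y * (ℓ * ℓ) ≤ (x + 2) * (ℓ * ℓ) :=
        mul_le_mul_of_nonneg_right (by linarith) (by positivity)
      nlinarith
  · refine ae_of_all _ fun ℓ y _ => ?_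
    have h1 : HasDerivAt (fun y : ℝ => -y * ℓ) (-ℓ) y := by
      simpa using ((hasDerivAt_id y).neg.mul_const ℓ)
    have h2 : HasDerivAt (fun y : ℝ => y * ℓ) ℓ y := by
      simpa using ((hasDerivAt_id y).mul_const ℓ)
    exact (h1.exp.sub_const 1).add h2

lemma aux_deriv_nonneg (pi : Measure ℝ) (x : ℝ) (hx : 0 < x) :
    0 ≤ ∫ ℓ in Set.Ioi (0 : ℝ), (Real.exp (-x * ℓ) * (-ℓ) + ℓ) ∂pi := by
  refine setIntegral_nonneg measurableSet_Ioi fun ℓ hℓ => ?_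
  have hℓ : 0 < ℓ := hℓ
  have h3 : Real.exp (-x * ℓ) ≤ 1 := Real.exp_le_one_iff.2 (by nlinarith)
  nlinarith

lemma aux_lim (pi : Measure ℝ)
    (hpi : IntegrableOn (fun ℓ => min ℓ (ℓ ^ 2)) (Set.Ioi 0) pi) :
    Tendsto (fun x => (∫ ℓ in Set.Ioi (0 : ℝ), (Real.exp (-x * ℓ) - 1 + x * ℓ) ∂pi) / x)
      (nhdsWithin 0 (Set.Ioi 0)) (nhds 0) := by
  have key : Tendsto (fun x => ∫ ℓ in Set.Ioi (0 : ℝ), (Real.exp (-x * ℓ) - 1 + x * ℓ) / x ∂pi)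
      (nhdsWithin 0 (Set.Ioi 0)) (nhds (∫ ℓ in Set.Ioi (0 : ℝ), (0 : ℝ) ∂pi)) := by
    refine tendsto_integral_filter_of_dominated_convergence (fun ℓ => min ℓ (ℓ ^ 2)) ?_ ?_ hpi ?_
    · exact Eventually.of_forall fun x =>
        (by fun_prop : Continuous fun ℓ => (Real.exp (-x * ℓ) - 1 + x * ℓ) / x).aestronglyMeasurable
    · filter_upwards [Ioo_mem_nhdsGT (zero_lt_one' ℝ)] with x hx
      refine (ae_restrict_iff' measurableSet_Ioi).2 (ae_of_all _ fun ℓ hℓ => ?_)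
      have hℓ : 0 < ℓ := hℓ
      obtain ⟨hx0, hx1⟩ := hx
      obtain ⟨h1, h2, h3⟩ := aux_exp (x * ℓ) (by positivity)
      rw [neg_mul, Real.norm_of_nonneg (by positivity), div_le_iff₀ hx0]
      rcases min_cases ℓ (ℓ ^ 2) with ⟨h, _⟩ | ⟨h, _⟩ <;> rw [h]
      · linarith
      · have : x * (x * ℓ ^ 2) ≤ 1 * (x * ℓ ^ 2) :=
          mul_le_mul_of_nonneg_right hx1.le (by positivity)
        nlinarith
    · refine (ae_restrict_iff' measurableSet_Ioi).2 (ae_of_all _ fun ℓ hℓ => ?_)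
      have hℓ : 0 < ℓ := hℓ
      have hb : Tendsto (fun x : ℝ => x * ℓ ^ 2) (nhdsWithin 0 (Set.Ioi 0)) (nhds 0) := by
        have : Continuous fun x : ℝ => x * ℓ ^ 2 := by fun_prop
        simpa using (this.tendsto 0).mono_left nhdsWithin_le_nhds
      refine squeeze_zero' ?_ ?_ hb
      · filter_upwards [self_mem_nhdsWithin] with x hx
        have hx : 0 < x := hx
        obtain ⟨h1, h2, h3⟩ := aux_exp (x * ℓ) (by positivity)
        rw [neg_mul]; positivity
      · filter_upwards [self_mem_nhdsWithin] with x hx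
        have hx : 0 < x := hx
        obtain ⟨h1, h2, h3⟩ := aux_exp (x * ℓ) (by positivity)
        rw [neg_mul, div_le_iff₀ hx]; nlinarith
  simpa [MeasureTheory.integral_div] using key

lemma core (α : ℝ) (hα : 0 < α) (ψ ψ' : ℝ → ℝ)
    (hd : ∀ x, 0 < x → HasDerivAt ψ (ψ' x) x) (hd' : ∀ x, 0 < x → α ≤ ψ' x)
    (hpos : ∀ x, 0 < x → 0 < ψ x)
    (hlim : Tendsto (fun x => ψ x / x) (nhdsWithin 0 (Set.Ioi 0)) (nhds α))
    (u : ℝ → ℝ → ℝ)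
    (hu : ∀ l : ℝ, 0 < l → ∀ t : ℝ, 0 ≤ t →
      u l t ∈ Set.Ioc 0 l ∧ (∫ r in (u l t)..l, (ψ r)⁻¹) = t)
    (hA1 : IntegrableOn (fun v => (ψ v)⁻¹) (Set.Ioi 1))
    (c : ℝ → ℝ)
    (hc : ∀ t : ℝ, 0 < t →
      c t ∈ Set.Ioi (0 : ℝ) ∧ (∫ v in Set.Ioi (c t), (ψ v)⁻¹) = t)
    (k l : ℝ) (hl : 0 < l) (hk : 0 < k) (hck : c k = l)
    (κ : ℝ) (hκ : 0 < κ)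
    (hκlim : Tendsto (fun t => c t * Real.exp (α * t)) atTop (nhds κ)) :
      Real.exp (-∫ s in Set.Ioi (0 : ℝ), (deriv ψ (u l s) - α)) =
        κ * α * Real.exp (-α * k) / ψ l := by
  have hcont : ContinuousOn (fun v => (ψ v)⁻¹) (Set.Ioi 0) := fun x hx =>
    ((hd x hx).continuousAt.inv₀ (hpos x hx).ne').continuousWithinAt
  have hmono : MonotoneOn ψ (Set.Ioi 0) := by
    refine monotoneOn_of_deriv_nonneg (convex_Ioi 0)
      (fun x hx => (hd x hx).continuousAt.continuousWithinAt) ?_ ?_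
    · rw [interior_Ioi]; exact fun x hx => (hd x hx).differentiableAt.differentiableWithinAt
    · rw [interior_Ioi]; intro x hx; rw [(hd x hx).deriv]; exact hα.le.trans (hd' x hx)
  have hii : ∀ a b, 0 < a → 0 < b → IntervalIntegrable (fun v => (ψ v)⁻¹) volume a b := by
    intro a b ha hb
    refine (hcont.mono ?_).intervalIntegrable
    intro x hx
    exact lt_of_lt_of_le (lt_min ha hb) hx.1
  have hioi : ∀ a, 0 < a → IntegrableOn (fun v => (ψ v)⁻¹) (Set.Ioi a) := by
    intro a ha
    rcases le_total a 1 with h | h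
    · rw [← Set.Ioc_union_Ioi_eq_Ioi h]
      exact ((intervalIntegrable_iff_integrableOn_Ioc_of_le h).1 (hii a 1 ha one_pos)).union hA1
    · exact hA1.mono_set (Set.Ioi_subset_Ioi h)
  have hsplit : ∀ a b, 0 < a → 0 < b → (∫ v in Set.Ioi a, (ψ v)⁻¹) =
      (∫ v in a..b, (ψ v)⁻¹) + ∫ v in Set.Ioi b, (ψ v)⁻¹ := by
    intro a b ha hb
    have := integral_Ioi_sub_Ioi' (hioi a ha) (hioi b hb)
    linarith
  have hlow : ∀ a b, 0 < a → a ≤ b → b ≤ l → (b - a) / ψ l ≤ ∫ v in a..b, (ψ v)⁻¹ := by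
    intro a b ha hab hbl
    have : ∫ v in a..b, (ψ l)⁻¹ ≤ ∫ v in a..b, (ψ v)⁻¹ := by
      refine integral_mono_on hab (by simp) (hii a b ha (ha.trans_le hab)) fun x hx => ?_
      have hx0 : 0 < x := ha.trans_le hx.1
      exact inv_anti₀ (hpos x hx0) (hmono hx0 hl (hx.2.trans hbl))
    simpa [div_eq_mul_inv] using this
  have hU := hu l hl
  have hsub : ∀ s t, 0 ≤ s → 0 ≤ t → ∫ v in (u l t)..(u l s), (ψ v)⁻¹ = t - s := by
    intro s t hs ht
    have h1 := integral_add_adjacent_intervals (hii _ _ (hU t ht).1.1 (hU s hs).1.1)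
      (hii _ _ (hU s hs).1.1 hl)
    rw [(hU t ht).2, (hU s hs).2] at h1
    linarith
  have hlip : ∀ s t, 0 ≤ s → 0 ≤ t → |u l s - u l t| ≤ ψ l * |s - t| := by
    have key : ∀ s t, 0 ≤ s → 0 ≤ t → u l t ≤ u l s → |u l s - u l t| ≤ ψ l * |s - t| := by
      intro s t hs ht h
      have h1 := hlow _ _ (hU t ht).1.1 h (hU s hs).1.2
      rw [hsub s t hs ht, div_le_iff₀ (hpos l hl)] at h1
      rw [abs_of_nonneg (by linarith), abs_sub_comm]
      have h2 := mul_le_mul_of_nonneg_right (le_abs_self (t - s)) (hpos l hl).le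
      linarith
    intro s t hs ht
    rcases le_total (u l t) (u l s) with h | h
    · exact key s t hs ht h
    · rw [abs_sub_comm, abs_sub_comm s]; exact key t s ht hs h
  have hucont : ContinuousOn (u l) (Set.Ici 0) := by
    have : LipschitzOnWith (Real.toNNReal (ψ l)) (u l) (Set.Ici 0) := by
      refine LipschitzOnWith.of_dist_le_mul fun s hs t ht => ?_
      rw [Real.coe_toNNReal _ (hpos l hl).le, Real.dist_eq, Real.dist_eq]
      exact hlip s t hs ht
    exact this.continuousOn
  have huderiv : ∀ s, 0 < s → HasDerivAt (u l) (-ψ (u l s)) s := by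
    intro s hs
    have hus := (hU s hs.le).1.1
    have h1 : HasDerivAt (fun v => ∫ r in v..l, (ψ r)⁻¹) (-(ψ (u l s))⁻¹) (u l s) := by
      refine integral_hasDerivAt_left (hii _ _ hus hl) ?_ (hcont.continuousAt (Ioi_mem_nhds hus))
      exact hcont.stronglyMeasurableAtFilter isOpen_Ioi _ hus
    have h2 := HasDerivAt.of_local_left_inverse (hucont.continuousAt (Ici_mem_nhds hs)) h1
      (neg_ne_zero.2 (inv_ne_zero (hpos _ hus).ne'))
      (by filter_upwards [Ioi_mem_nhds hs] with y hy
          exact (hU y (le_of_lt hy)).2)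
    simpa [inv_neg] using h2
  have hu0 : u l 0 = l := by
    have h1 := hlow _ _ (hU 0 le_rfl).1.1 (hU 0 le_rfl).1.2 le_rfl
    rw [(hU 0 le_rfl).2, div_le_iff₀ (hpos l hl)] at h1
    linarith [(hU 0 le_rfl).1.2]
  have hinj : ∀ a b, 0 < a → 0 < b → (∫ v in Set.Ioi a, (ψ v)⁻¹) = (∫ v in Set.Ioi b, (ψ v)⁻¹) →
      a = b := by
    have key : ∀ a b, 0 < a → a < b → (∫ v in Set.Ioi a, (ψ v)⁻¹) ≠
        (∫ v in Set.Ioi b, (ψ v)⁻¹) := by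
      intro a b ha hab h
      have hb := ha.trans hab
      have h1 := hsplit a b ha hb
      have h2 : 0 < ∫ v in a..b, (ψ v)⁻¹ :=
        intervalIntegral_pos_of_pos_on (hii a b ha hb)
          (fun x hx => inv_pos.2 (hpos x (ha.trans hx.1))) hab
      linarith
    intro a b ha hb h
    rcases lt_trichotomy a b with h' | h' | h'
    · exact absurd h (key a b ha h')
    · exact h'
    · exact absurd h.symm (key b a hb h')
  have huc : ∀ s, 0 ≤ s → u l s = c (s + k) := by
    intro s hs
    have hsk : 0 < s + k := by linarith
    refine hinj _ _ (hU s hs).1.1 (hc _ hsk).1 ?_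
    rw [(hc _ hsk).2, hsplit _ l (hU s hs).1.1 hl, (hU s hs).2]
    have := (hc k hk).2
    rw [hck] at this
    rw [this]
  have hue : Tendsto (fun s => u l s * Real.exp (α * s)) atTop (nhds (κ * Real.exp (-α * k))) := by
    have h1 := (hκlim.comp (tendsto_atTop_add_const_right atTop k tendsto_id)).mul_const
      (Real.exp (-α * k))
    refine h1.congr' ?_
    filter_upwards [eventually_ge_atTop 0] with s hs
    simp only [Function.comp, id]
    rw [huc s hs, mul_assoc, ← Real.exp_add]
    congr 2; ring
  have huz : Tendsto (u l) atTop (nhdsWithin 0 (Set.Ioi 0)) := by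
    refine tendsto_nhdsWithin_iff.2 ⟨?_, ?_⟩
    · have h1 : Tendsto (fun s => Real.exp (-(α * s))) atTop (nhds 0) :=
        Real.tendsto_exp_neg_atTop_nhds_zero.comp (tendsto_id.const_mul_atTop hα)
      have h2 := hue.mul h1
      rw [mul_zero] at h2
      refine h2.congr fun s => ?_
      rw [mul_assoc, ← Real.exp_add]; simp
    · filter_upwards [eventually_ge_atTop 0] with s hs using (hU s hs).1.1
  have hψe : Tendsto (fun s => ψ (u l s) * Real.exp (α * s)) atTop
      (nhds (α * (κ * Real.exp (-α * k)))) := by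
    refine ((hlim.comp huz).mul hue).congr' ?_
    filter_upwards [eventually_ge_atTop 0] with s hs
    have := (hU s hs).1.1.ne'
    simp only [Function.comp]
    field_simp
  have hLpos : 0 < α * (κ * Real.exp (-α * k)) := by positivity
  have hH : Tendsto (fun s => -Real.log (ψ (u l s)) - α * s) atTop
      (nhds (-Real.log (α * (κ * Real.exp (-α * k))))) := by
    refine (((Real.continuousAt_log hLpos.ne').tendsto.comp hψe).neg).congr' ?_
    filter_upwards [eventually_ge_atTop 0] with s hs
    simp only [Function.comp]
    rw [Real.log_mul (hpos _ (hU s hs).1.1).ne' (Real.exp_pos _).ne', Real.log_exp]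
    ring
  have hint : ∫ s in Set.Ioi (0 : ℝ), (deriv ψ (u l s) - α) =
      -Real.log (α * (κ * Real.exp (-α * k))) - (-Real.log (ψ (u l 0)) - α * 0) := by
    refine integral_Ioi_of_hasDerivAt_of_nonneg (g := fun s => -Real.log (ψ (u l s)) - α * s)
      ?_ ?_ ?_ hH
    · have h1 : ContinuousWithinAt (fun s => ψ (u l s)) (Set.Ici 0) 0 :=
        ContinuousAt.comp_continuousWithinAt (hd _ (hU 0 le_rfl).1.1).continuousAt
          (hucont 0 Set.self_mem_Ici)
      exact ((h1.log (hpos _ (hU 0 le_rfl).1.1).ne').neg).sub (by fun_prop)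
    · intro s hs
      have hs : 0 < s := hs
      have hus := (hU s hs.le).1.1
      have h1 := (((hd _ hus).comp s (huderiv s hs)).log (hpos _ hus).ne').neg.sub
        ((hasDerivAt_id s).const_mul α)
      refine h1.congr_deriv ?_
      rw [(hd _ hus).deriv]
      have := (hpos _ hus).ne'
      simp only [Function.comp]
      field_simp
    · intro s hs
      have hus := (hU s (le_of_lt hs)).1.1
      rw [(hd _ hus).deriv]
      linarith [hd' _ hus]
  rw [hint, hu0, mul_zero, sub_zero, sub_neg_eq_add, neg_add, neg_neg, Real.exp_add,
    Real.exp_log hLpos, Real.exp_neg, Real.exp_log (hpos l hl)]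
  ring

/-- Under (A1) and (A2), for every `λ > 0`,
`exp( −∫_0^∞ ψ̃'(u(λ,s)) ds ) = κ_* α e^{−α c⁻¹(λ)} / ψ(λ)` (closed form of the
Laplace transform of the stationary population size). -/
theorem stmt12 (α β : ℝ) (hα : 0 < α) (hβ : 0 ≤ β)
    (pi : Measure ℝ)
    (hpi : IntegrableOn (fun ℓ => min ℓ (ℓ ^ 2)) (Set.Ioi 0) pi)
    (hnontriv : 0 < β ∨ pi (Set.Ioo 0 1) = ⊤)
    (ψ : ℝ → ℝ)
    (hψ : ∀ l : ℝ, ψ l = α * l + β * l ^ 2 +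
      ∫ ℓ in Set.Ioi (0 : ℝ), (Real.exp (-l * ℓ) - 1 + l * ℓ) ∂pi)
    (u : ℝ → ℝ → ℝ)
    (hu : ∀ l : ℝ, 0 < l → ∀ t : ℝ, 0 ≤ t →
      u l t ∈ Set.Ioc 0 l ∧ (∫ r in (u l t)..l, (ψ r)⁻¹) = t)
    (hA1 : IntegrableOn (fun v => (ψ v)⁻¹) (Set.Ioi 1))
    (hA2 : IntegrableOn (fun ℓ => ℓ * Real.log ℓ) (Set.Ioi 1) pi)
    (c : ℝ → ℝ)
    (hc : ∀ t : ℝ, 0 < t →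
      c t ∈ Set.Ioi (0 : ℝ) ∧ (∫ v in Set.Ioi (c t), (ψ v)⁻¹) = t)
    (cinv : ℝ → ℝ)
    (hcinv : ∀ l : ℝ, 0 < l → 0 < cinv l ∧ c (cinv l) = l)
    (κ : ℝ) (hκ : 0 < κ)
    (hκlim : Tendsto (fun t => c t * Real.exp (α * t)) atTop (nhds κ)) :
    ∀ l : ℝ, 0 < l →
      Real.exp (-∫ s in Set.Ioi (0 : ℝ), (deriv ψ (u l s) - α)) =
        κ * α * Real.exp (-α * cinv l) / ψ l := by
  intro l hl
  have hψ0 : ψ = fun l => α * l + β * l ^ 2 +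
      ∫ ℓ in Set.Ioi (0 : ℝ), (Real.exp (-l * ℓ) - 1 + l * ℓ) ∂pi := funext hψ
  refine core α hα ψ (fun x => α + β * (2 * x) +
      ∫ ℓ in Set.Ioi (0 : ℝ), (Real.exp (-x * ℓ) * (-ℓ) + ℓ) ∂pi) ?_ ?_ ?_ ?_ u hu hA1 c hc
      (cinv l) l hl (hcinv l hl).1 (hcinv l hl).2 κ hκ hκlim
  · intro x hx
    rw [hψ0]
    refine HasDerivAt.add ?_ (aux_deriv pi hpi x hx)
    have h1 := ((hasDerivAt_id x).const_mul α).add ((hasDerivAt_pow 2 x).const_mul β)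
    refine h1.congr_deriv ?_
    simp
  · intro x hx
    have := aux_deriv_nonneg pi x hx
    have : 0 ≤ β * (2 * x) := by positivity
    linarith
  · intro x hx
    rw [hψ x]
    have : 0 ≤ ∫ ℓ in Set.Ioi (0 : ℝ), (Real.exp (-x * ℓ) - 1 + x * ℓ) ∂pi := by
      refine setIntegral_nonneg measurableSet_Ioi fun ℓ hℓ => ?_
      have hℓ : 0 < ℓ := hℓ
      rw [neg_mul]
      exact (aux_exp (x * ℓ) (by positivity)).1
    positivity
  · have h1 : Tendsto (fun x : ℝ => α + β * x) (nhdsWithin 0 (Set.Ioi 0)) (nhds α) := by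
      have : Continuous fun x : ℝ => α + β * x := by fun_prop
      simpa using (this.tendsto 0).mono_left nhdsWithin_le_nhds
    have h2 := h1.add (aux_lim pi hpi)
    rw [add_zero] at h2
    refine h2.congr' ?_
    filter_upwards [self_mem_nhdsWithin] with x hx
    have hx : x ≠ 0 := ne_of_gt hx
    rw [hψ x, add_div]
    congr 1
    field_simp
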